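/- Continuity theorem for Bernstein transforms: Let (a₀^{(k)}, a_∞^{(k)}, μ_k) be a sequence of Lévy triples with Bernstein transforms f_k(q) = a₀^{(k)} q + a_∞^{(k)} + ∫(1−e^{−qx}) dμ_k(x), and associated finite measures κ_k on [0,∞] given by dκ_k = a₀^{(k)} dδ₀ + a_∞^{(k)} dδ_∞ + (x∧1)dμ_k. Then f_k converges pointwise on (0,∞) if and only if κ_k converges weak-star on [0,∞] to some finite measure κ; and in that case the limit f is the Bernstein transform of the Lévy triple associated to κ. -/

import Mathlib

open MeasureTheory Filter
open scoped ENNReal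

/-- The test function `g_q` on the compactified half-line `[0,∞] = ℝ≥0∞`. -/
noncomputable def gq (q : ℝ) : ℝ≥0∞ → ℝ := fun x =>
  if x = 0 then q
  else if x = ⊤ then 1
  else (1 - Real.exp (-q * x.toReal)) / min x.toReal 1

/-- The finite measure on `[0,∞]` associated to a Lévy triple `(a₀, a_∞, μ)`. -/
noncomputable def levyKappa (a0 aInf : ℝ) (μ : Measure ℝ) : Measure ℝ≥0∞ :=
  ENNReal.ofReal a0 • Measure.dirac 0 + ENNReal.ofReal aInf • Measure.dirac ⊤ +
    Measure.map ENNReal.ofReal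
      ((μ.restrict (Set.Ioi 0)).withDensity fun x => ENNReal.ofReal (min x 1))

open Topology

section WeakStarLimits

variable {X : Type*} [TopologicalSpace X] [CompactSpace X] [MeasurableSpace X]
  [BorelSpace X]

/-- Pointwise limits of the functionals induced by finite measures on a compact space are
represented by a finite measure. -/
theorem exists_isFiniteMeasure_tendsto_integral [T2Space X] (κ : ℕ → Measure X)
    [∀ k, IsFiniteMeasure (κ k)]
    (h : ∀ g : C(X, ℝ), ∃ L : ℝ, Tendsto (fun k => ∫ x, g x ∂(κ k)) atTop (𝓝 L)) :
    ∃ ν : Measure X, IsFiniteMeasure ν ∧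
      ∀ g : C(X, ℝ), Tendsto (fun k => ∫ x, g x ∂(κ k)) atTop (𝓝 (∫ x, g x ∂ν)) := by
  choose L hL using h
  have hint : ∀ (g : C(X, ℝ)) k, Integrable (fun x => g x) (κ k) := fun g k =>
    g.continuous.integrable_of_hasCompactSupport (HasCompactSupport.of_compactSpace _)
  let Λ : CompactlySupportedContinuousMap X ℝ →ₗ[ℝ] ℝ :=
    { toFun := fun g => L g
      map_add' := fun g₁ g₂ => by
        refine tendsto_nhds_unique (hL _) (((hL g₁).add (hL g₂)).congr fun k => ?_)
        exact (integral_add (hint g₁ k) (hint g₂ k)).symm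
      map_smul' := fun c g => by
        refine tendsto_nhds_unique (hL _) (((hL g).const_mul c).congr fun k => ?_)
        exact (integral_const_mul c _).symm }
  have hΛ : ∀ g, 0 ≤ g → 0 ≤ Λ g := fun g hg =>
    ge_of_tendsto' (hL g) fun k => integral_nonneg fun x => hg x
  refine ⟨RealRMK.rieszMeasure (PositiveLinearMap.mk₀ Λ hΛ), inferInstance, fun g => ?_⟩
  have := RealRMK.integral_rieszMeasure (PositiveLinearMap.mk₀ Λ hΛ)
    (CompactlySupportedContinuousMap.continuousMapEquiv g)
  simp only [CompactlySupportedContinuousMap.continuousMapEquiv_apply_toFun] at this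
  rw [this]
  exact hL g

/-- If the masses are bounded, the continuous functions whose integrals converge form a closed
set. -/
theorem isClosed_setOf_exists_tendsto_integral (κ : ℕ → Measure X) [∀ k, IsFiniteMeasure (κ k)]
    {h : C(X, ℝ)} (hpos : ∀ x, 0 ≤ h x) {C : ℝ} (hC : ∀ k, ∫ x, h x ∂(κ k) ≤ C) :
    IsClosed {g : C(X, ℝ) | ∃ L : ℝ, Tendsto (fun k => ∫ x, g x * h x ∂(κ k)) atTop (𝓝 L)} := by
  have hint : ∀ (g : C(X, ℝ)) k, Integrable (fun x => g x) (κ k) := fun g k =>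
    g.continuous.integrable_of_hasCompactSupport (HasCompactSupport.of_compactSpace _)
  have hC0 : 0 ≤ C := (integral_nonneg hpos).trans (hC 0)
  have hdist : ∀ (g₁ g₂ : C(X, ℝ)) k,
      |∫ x, g₁ x * h x ∂(κ k) - ∫ x, g₂ x * h x ∂(κ k)| ≤ dist g₁ g₂ * C := by
    intro g₁ g₂ k
    have hmul : ∀ g : C(X, ℝ), Integrable (fun x => g x * h x) (κ k) := fun g => hint (g * h) k
    rw [← integral_sub (hmul g₁) (hmul g₂)]
    calc |∫ x, g₁ x * h x - g₂ x * h x ∂(κ k)|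
        ≤ ∫ x, dist g₁ g₂ * h x ∂(κ k) := by
          rw [← Real.norm_eq_abs]
          refine norm_integral_le_of_norm_le ((hint h k).const_mul _)
            (Eventually.of_forall fun x => ?_)
          rw [← sub_mul, norm_mul, Real.norm_of_nonneg (hpos x), ← dist_eq_norm]
          exact mul_le_mul_of_nonneg_right (ContinuousMap.dist_apply_le_dist x) (hpos x)
      _ = dist g₁ g₂ * ∫ x, h x ∂(κ k) := integral_const_mul _ _
      _ ≤ dist g₁ g₂ * C := mul_le_mul_of_nonneg_left (hC k) dist_nonneg
  refine isClosed_of_closure_subset fun g hg => ?_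
  refine cauchySeq_tendsto_of_complete (Metric.cauchySeq_iff'.2 fun ε hε => ?_)
  obtain ⟨g', ⟨L, hL⟩, hgg'⟩ := Metric.mem_closure_iff.1 hg (ε / (4 * (C + 1))) (by positivity)
  obtain ⟨N, hN⟩ := Metric.cauchySeq_iff'.1 hL.cauchySeq (ε / 2) (by positivity)
  have hsmall : dist g g' * C ≤ ε / 4 := by
    calc dist g g' * C ≤ ε / (4 * (C + 1)) * (C + 1) :=
          mul_le_mul hgg'.le (by linarith) hC0 (by positivity)
      _ = ε / 4 := by field_simp
  refine ⟨N, fun n hn => ?_⟩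
  have h₁ := abs_le.1 ((hdist g g' n).trans hsmall)
  have h₂ := abs_le.1 ((hdist g g' N).trans hsmall)
  have h₃ := abs_lt.1 (Real.dist_eq _ _ ▸ hN n hn)
  rw [Real.dist_eq, abs_lt]
  constructor <;> linarith [h₁.1, h₁.2, h₂.1, h₂.2, h₃.1, h₃.2]

/-- Weak-star convergence on a compact space follows from convergence of weighted moments of an
injective continuous function. -/
theorem exists_isFiniteMeasure_tendsto_of_tendsto_moments [T2Space X] (κ : ℕ → Measure X)
    [∀ k, IsFiniteMeasure (κ k)] {e h : C(X, ℝ)} (he : Function.Injective e)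
    (hpos : ∀ x, 0 < h x)
    (hmom : ∀ n : ℕ, ∃ L : ℝ, Tendsto (fun k => ∫ x, e x ^ n * h x ∂(κ k)) atTop (𝓝 L)) :
    ∃ ν : Measure X, IsFiniteMeasure ν ∧
      ∀ g : C(X, ℝ), Tendsto (fun k => ∫ x, g x ∂(κ k)) atTop (𝓝 (∫ x, g x ∂ν)) := by
  have hint : ∀ (g : C(X, ℝ)) k, Integrable (fun x => g x) (κ k) := fun g k =>
    g.continuous.integrable_of_hasCompactSupport (HasCompactSupport.of_compactSpace _)
  have hbdd : ∃ C, ∀ k, ∫ x, h x ∂(κ k) ≤ C := by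
    obtain ⟨L, hL⟩ := hmom 0
    obtain ⟨C, hC⟩ := hL.bddAbove_range
    exact ⟨C, fun k => by simpa using hC (Set.mem_range_self k)⟩
  obtain ⟨C, hC⟩ := hbdd
  have hclosed := isClosed_setOf_exists_tendsto_integral κ (fun x => (hpos x).le) hC
  have hpoly : ((Algebra.adjoin ℝ {e} : Subalgebra ℝ C(X, ℝ)) : Set C(X, ℝ)) ⊆
      {g : C(X, ℝ) | ∃ L : ℝ, Tendsto (fun k => ∫ x, g x * h x ∂(κ k)) atTop (𝓝 L)} := by
    intro g hg
    rw [SetLike.mem_coe, Algebra.adjoin_singleton_eq_range_aeval] at hg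
    obtain ⟨p, rfl⟩ := hg
    induction p using Polynomial.induction_on' with
    | add p q hp hq =>
      obtain ⟨L₁, h₁⟩ := hp
      obtain ⟨L₂, h₂⟩ := hq
      refine ⟨L₁ + L₂, (h₁.add h₂).congr fun k => ?_⟩
      have hmul : ∀ g : C(X, ℝ), Integrable (fun x => g x * h x) (κ k) :=
        fun g => hint (g * h) k
      rw [← integral_add (hmul _) (hmul _)]
      simp [add_mul]
    | monomial n a =>
      obtain ⟨L, hL⟩ := hmom n
      refine ⟨a * L, (hL.const_mul a).congr fun k => ?_⟩
      rw [← integral_const_mul]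
      simp [Polynomial.aeval_monomial, mul_assoc]
  have hdense : ∀ g : C(X, ℝ), g ∈ closure
      ((Algebra.adjoin ℝ {e} : Subalgebra ℝ C(X, ℝ)) : Set C(X, ℝ)) := by
    intro g
    refine ContinuousMap.continuousMap_mem_subalgebra_closure_of_separatesPoints _ ?_ g
    exact fun x y hxy => ⟨e, ⟨e, Algebra.subset_adjoin rfl, rfl⟩, he.ne hxy⟩
  refine exists_isFiniteMeasure_tendsto_integral κ fun g => ?_
  obtain ⟨L, hL⟩ := closure_minimal hpoly hclosed
    (hdense ⟨fun x => g x / h x, g.continuous.div h.continuous fun x => (hpos x).ne'⟩)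
  refine ⟨L, hL.congr fun k => integral_congr_ae (Eventually.of_forall fun x => ?_)⟩
  exact div_mul_cancel₀ _ (hpos x).ne'

end WeakStarLimits

/-- A continuous function of `x.toReal` with a limit at infinity is continuous on `[0,∞]`. -/
theorem ENNReal.continuous_of_toReal {F : ℝ≥0∞ → ℝ} {φ : ℝ → ℝ} (hφ : Continuous φ)
    (hF : ∀ x, x ≠ ⊤ → F x = φ x.toReal) (htop : Tendsto φ atTop (𝓝 (F ⊤))) :
    Continuous F := by
  refine continuous_iff_continuousAt.2 fun x => ?_
  by_cases hx : x = ⊤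
  · subst hx
    rw [continuousAt_iff_punctured_nhds]
    have hlim : Tendsto ENNReal.toReal (𝓝[≠] ⊤) atTop := by
      refine tendsto_atTop.2 fun b => ?_
      filter_upwards [nhdsWithin_le_nhds (lt_mem_nhds (ENNReal.ofReal_lt_top (r := b))),
        self_mem_nhdsWithin] with y hy hy'
      exact (ENNReal.ofReal_le_iff_le_toReal hy').1 hy.le
    refine (htop.comp hlim).congr' ?_
    filter_upwards [self_mem_nhdsWithin] with y hy
    exact (hF y hy).symm
  · have hev : F =ᶠ[𝓝 x] φ ∘ ENNReal.toReal := by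
      filter_upwards [isOpen_ne.mem_nhds hx] with y hy
      exact hF y hy
    exact (hφ.continuousAt.comp (ENNReal.tendsto_toReal hx)).congr hev.symm

/-- The function `x ↦ e^{-x}` on `[0,∞]`. -/
noncomputable def expNeg (x : ℝ≥0∞) : ℝ := if x = ⊤ then 0 else Real.exp (-x.toReal)

theorem continuous_expNeg : Continuous expNeg := by
  refine ENNReal.continuous_of_toReal (φ := fun t => Real.exp (-t)) (by fun_prop)
    (fun x hx => if_neg hx) ?_
  simpa [expNeg] using Real.tendsto_exp_neg_atTop_nhds_zero

theorem expNeg_injective : Function.Injective expNeg := by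
  intro x y hxy
  by_cases hx : x = ⊤ <;> by_cases hy : y = ⊤ <;> simp [expNeg, hx, hy] at hxy ⊢
  · exact absurd hxy.symm (Real.exp_ne_zero _)
  · exact (ENNReal.toReal_eq_toReal_iff' hx hy).1 hxy

theorem continuous_gq {q : ℝ} (hq : 0 < q) : Continuous (gq q) := by
  set ψ : ℝ → ℝ := fun t => 1 - Real.exp (-q * t) with hψ
  have hderiv : HasDerivAt ψ q 0 := by
    have := (((hasDerivAt_id (0 : ℝ)).const_mul (-q)).exp).const_sub 1
    simpa [hψ] using this
  have hcont : Continuous (dslope ψ 0) := by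
    refine continuous_iff_continuousAt.2 fun t => ?_
    rcases eq_or_ne t 0 with rfl | ht
    · exact continuousAt_dslope_same.2 hderiv.differentiableAt
    · exact (continuousAt_dslope_of_ne ht).2 (by fun_prop)
  refine ENNReal.continuous_of_toReal (φ := fun t => dslope ψ 0 t * max t 1)
    (by fun_prop) (fun x hx => ?_) ?_
  · rcases eq_or_ne x 0 with rfl | hx0
    · simp [gq, dslope_same, hderiv.deriv]
    · have ht : 0 < x.toReal := ENNReal.toReal_pos hx0 hx
      have hmin : 0 < min x.toReal 1 := lt_min ht one_pos
      simp only [gq, hx0, hx, if_false]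
      rw [dslope_of_ne _ ht.ne', slope_def_field, div_eq_iff hmin.ne', mul_assoc,
        max_mul_min]
      simp only [hψ, mul_zero, Real.exp_zero, sub_self, sub_zero, mul_one]
      exact (div_mul_cancel₀ _ ht.ne').symm
  · have hlim : Tendsto ψ atTop (𝓝 1) := by
      have h₁ : Tendsto (fun t : ℝ => -q * t) atTop atBot :=
        tendsto_id.const_mul_atTop_of_neg (by linarith)
      simpa [hψ] using (Real.tendsto_exp_atBot.comp h₁).const_sub 1
    rw [show gq q ⊤ = 1 by simp [gq]]
    refine hlim.congr' ?_
    filter_upwards [eventually_ge_atTop 1] with t ht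
    have ht0 : t ≠ 0 := by positivity
    rw [dslope_of_ne _ ht0, slope_def_field, max_eq_left ht]
    simp only [hψ, mul_zero, Real.exp_zero, sub_self, sub_zero]
    exact (div_mul_cancel₀ _ ht0).symm

theorem gq_pos {q : ℝ} (hq : 0 < q) (x : ℝ≥0∞) : 0 < gq q x := by
  by_cases h0 : x = 0
  · simpa [gq, h0] using hq
  by_cases ht : x = ⊤
  · simp [gq, ht]
  have hx : 0 < x.toReal := ENNReal.toReal_pos h0 ht
  simp only [gq, h0, ht, if_false]
  refine div_pos (sub_pos.2 (Real.exp_lt_one_iff.2 ?_)) (lt_min hx one_pos)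
  nlinarith

theorem expNeg_pow_mul_gq_one (n : ℕ) (hn : n ≠ 0) (x : ℝ≥0∞) :
    expNeg x ^ n * gq 1 x = gq (n + 1) x - gq n x := by
  by_cases h0 : x = 0
  · simp [gq, expNeg, h0]
  by_cases ht : x = ⊤
  · simp [gq, expNeg, ht, hn]
  simp only [gq, expNeg, h0, ht, if_false]
  rw [← sub_div, ← mul_div_assoc, ← Real.exp_nat_mul, mul_sub, ← Real.exp_add]
  congr 1
  ring_nf

theorem isFiniteMeasure_levyKappa (a aInf : ℝ) {μ : Measure ℝ}
    (hμ : (∫⁻ x in Set.Ioi (0 : ℝ), ENNReal.ofReal (min x 1) ∂μ) < ⊤) :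
    IsFiniteMeasure (levyKappa a aInf μ) := by
  have : IsFiniteMeasure
      ((μ.restrict (Set.Ioi 0)).withDensity fun x => ENNReal.ofReal (min x 1)) :=
    isFiniteMeasure_withDensity hμ.ne
  have h₁ : IsFiniteMeasure (ENNReal.ofReal a • Measure.dirac (0 : ℝ≥0∞)) :=
    Measure.smul_finite _ ENNReal.ofReal_ne_top
  have h₂ : IsFiniteMeasure (ENNReal.ofReal aInf • Measure.dirac (⊤ : ℝ≥0∞)) :=
    Measure.smul_finite _ ENNReal.ofReal_ne_top
  unfold levyKappa
  infer_instance

/-- The Bernstein transform of a Lévy triple is the integral of `g_q` against its finite measure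
on `[0,∞]`. -/
theorem integral_gq_levyKappa {a aInf : ℝ} (ha : 0 ≤ a) (haInf : 0 ≤ aInf) {μ : Measure ℝ}
    (hμ : (∫⁻ x in Set.Ioi (0 : ℝ), ENNReal.ofReal (min x 1) ∂μ) < ⊤) {q : ℝ} (hq : 0 < q) :
    ∫ x, gq q x ∂(levyKappa a aInf μ) =
      a * q + aInf + ∫ x in Set.Ioi (0 : ℝ), (1 - Real.exp (-q * x)) ∂μ := by
  have := isFiniteMeasure_levyKappa a aInf hμ
  have hcont := continuous_gq hq
  have hint : Integrable (gq q) (levyKappa a aInf μ) :=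
    hcont.integrable_of_hasCompactSupport (HasCompactSupport.of_compactSpace _)
  have hmeas : Measurable fun x : ℝ => ENNReal.ofReal (min x 1) := by fun_prop
  unfold levyKappa at hint ⊢
  rw [integral_add_measure hint.left_of_add_measure hint.right_of_add_measure,
    integral_add_measure hint.left_of_add_measure.left_of_add_measure
      hint.left_of_add_measure.right_of_add_measure,
    integral_smul_measure, integral_smul_measure, integral_dirac, integral_dirac,
    integral_map ENNReal.measurable_ofReal.aemeasurable hcont.aestronglyMeasurable,
    integral_withDensity_eq_integral_toReal_smul hmeas
      (Eventually.of_forall fun x => ENNReal.ofReal_lt_top)]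
  congr 1
  · simp [gq, ENNReal.toReal_ofReal, ha, haInf]
  · refine setIntegral_congr_fun measurableSet_Ioi fun x hx => ?_
    have hx : 0 < x := hx
    have hmin : 0 < min x 1 := lt_min hx one_pos
    simp only [gq, ENNReal.ofReal_eq_zero, not_le.2 hx, ENNReal.ofReal_ne_top, if_false,
      ENNReal.toReal_ofReal hx.le, ENNReal.toReal_ofReal hmin.le, smul_eq_mul]
    exact mul_div_cancel₀ _ hmin.ne'

theorem continuity_theorem_bernstein_transforms
    (a0 aInf : ℕ → ℝ) (ha0 : ∀ k, 0 ≤ a0 k) (haInf : ∀ k, 0 ≤ aInf k)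
    (μ : ℕ → Measure ℝ)
    (hμfin : ∀ k, (∫⁻ x in Set.Ioi (0 : ℝ), ENNReal.ofReal (min x 1) ∂(μ k)) < ⊤)
    (f : ℕ → ℝ → ℝ)
    (hf : ∀ k q, f k q =
      a0 k * q + aInf k + ∫ x in Set.Ioi (0 : ℝ), (1 - Real.exp (-q * x)) ∂(μ k)) :
    ((∀ q : ℝ, 0 < q → ∃ L : ℝ, Tendsto (fun k => f k q) atTop (nhds L)) ↔
      (∃ κ : Measure ℝ≥0∞, IsFiniteMeasure κ ∧
        ∀ g : C(ℝ≥0∞, ℝ), Tendsto (fun k => ∫ x, g x ∂(levyKappa (a0 k) (aInf k) (μ k)))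
          atTop (nhds (∫ x, g x ∂κ))))
    ∧
    (∀ κ : Measure ℝ≥0∞, IsFiniteMeasure κ →
      (∀ g : C(ℝ≥0∞, ℝ), Tendsto (fun k => ∫ x, g x ∂(levyKappa (a0 k) (aInf k) (μ k)))
        atTop (nhds (∫ x, g x ∂κ))) →
      ∀ q : ℝ, 0 < q → Tendsto (fun k => f k q) atTop (nhds (∫ x, gq q x ∂κ))) := by
  have hfin k : IsFiniteMeasure (levyKappa (a0 k) (aInf k) (μ k)) :=
    isFiniteMeasure_levyKappa _ _ (hμfin k)
  have hfκ : ∀ k q, 0 < q → ∫ x, gq q x ∂(levyKappa (a0 k) (aInf k) (μ k)) = f k q := by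
    intro k q hq
    rw [hf, integral_gq_levyKappa (ha0 k) (haInf k) (hμfin k) hq]
  have hlim : ∀ κ : Measure ℝ≥0∞, IsFiniteMeasure κ →
      (∀ g : C(ℝ≥0∞, ℝ), Tendsto (fun k => ∫ x, g x ∂(levyKappa (a0 k) (aInf k) (μ k)))
        atTop (nhds (∫ x, g x ∂κ))) →
      ∀ q : ℝ, 0 < q → Tendsto (fun k => f k q) atTop (nhds (∫ x, gq q x ∂κ)) :=
    fun κ _ hκ q hq => (hκ ⟨gq q, continuous_gq hq⟩).congr fun k => hfκ k q hq
  refine ⟨⟨fun hconv => ?_, fun ⟨κ, hκ, hw⟩ q hq => ⟨_, hlim κ hκ hw q hq⟩⟩, hlim⟩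
  refine exists_isFiniteMeasure_tendsto_of_tendsto_moments _
    (e := ⟨expNeg, continuous_expNeg⟩) (h := ⟨gq 1, continuous_gq one_pos⟩)
    expNeg_injective (gq_pos one_pos) fun n => ?_
  simp only [ContinuousMap.coe_mk]
  rcases eq_or_ne n 0 with rfl | hn
  · obtain ⟨L, hL⟩ := hconv 1 one_pos
    exact ⟨L, hL.congr fun k => by simp [hfκ k 1 one_pos]⟩
  · have hn0 : (0 : ℝ) < n := by positivity
    have hn1 : (0 : ℝ) < n + 1 := by positivity
    obtain ⟨L₁, h₁⟩ := hconv (n + 1) hn1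
    obtain ⟨L₂, h₂⟩ := hconv n hn0
    refine ⟨L₁ - L₂, (h₁.sub h₂).congr fun k => ?_⟩
    simp only [expNeg_pow_mul_gq_one n hn]
    rw [integral_sub
      ((continuous_gq hn1).integrable_of_hasCompactSupport (HasCompactSupport.of_compactSpace _))
      ((continuous_gq hn0).integrable_of_hasCompactSupport (HasCompactSupport.of_compactSpace _)),
      hfκ k _ hn1, hfκ k _ hn0]
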